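/- Let k be a field and A a noetherian k-algebra that is a-adically complete for some ideal a ⊆ A. Then for every finitely generated A-module M and every n, the ordinary Hochschild cohomology HH^n(A|k; M) = Ext^n_{A⊗_k A}(A, M) is isomorphic to the adic (topological) Hochschild cohomology ĤH^n(A|k; M) = Ext^n_{\widehat{A⊗_k A}}(A, M), where \widehat{A⊗_k A} is the completion of A⊗_k A at the ideal a⊗_k A + A⊗_k a. -/

import Mathlib

open CategoryTheory
open scoped TensorProduct

noncomputable section

namespace Adhoc19

variable (k A : Type) [Field k] [CommRing A] [Algebra k A]

/-- The multiplication map `A ⊗ₖ A → A`. -/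
def mulMap : (A ⊗[k] A) →+* A := (Algebra.TensorProduct.lmul' k (S := A)).toRingHom

/-- `A` as a module over the enveloping algebra `A ⊗ₖ A`, via multiplication. -/
instance instEnvA : Module (A ⊗[k] A) A := Module.compHom A (mulMap k A)

variable (M : Type) [AddCommGroup M] [Module A M]

/-- An `A`-module as a module over the enveloping algebra `A ⊗ₖ A`. -/
instance instEnvM : Module (A ⊗[k] A) M :=
  Module.compHom M (mulMap k A)

/-- The ideal `a^e = a ⊗ A + A ⊗ a` of `A ⊗ₖ A`. -/
def ae (a : Ideal A) : Ideal (A ⊗[k] A) :=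
  a.map (Algebra.TensorProduct.includeLeftRingHom (R := k))
    + a.map (Algebra.TensorProduct.includeRight (R := k) (A := A)).toRingHom

end Adhoc19

end

noncomputable section
open CategoryTheory Limits
namespace HCC

section ExtMap
open Abelian
universe w w' v v' u u'
variable {C : Type u} [Category.{v} C] [Abelian C]
variable {D : Type u'} [Category.{v'} D] [Abelian D]
variable (F : C ⥤ D) [F.Additive] [PreservesFiniteLimits F] [PreservesFiniteColimits F]

attribute [local simp] Ext.mapExactFunctor_comp Ext.mapExactFunctor_mk₀ Ext.mapExactFunctor_extClass

lemma mapExt_bijective (Pc : C → Prop) (hPc : ∀ X : C, ∃ (P : C) (f : P ⟶ X), Projective P ∧ Epi f ∧ Pc P)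
    [HasExt.{w} C] [HasExt.{w'} D] (Y : C)
    (h0 : ∀ X : C, Function.Bijective (fun f : X ⟶ Y => F.map f))
    (h1 : ∀ (P : C) (n : ℕ), Pc P → Subsingleton (Ext (F.obj P) (F.obj Y) (n + 1)))
    (X : C) (n : ℕ) :
    Function.Bijective (F.mapExtAddHom X Y n) := by
  induction n generalizing X with
  | zero => simpa [Ext.mapExactFunctor₀] using h0 X
  | succ n hn =>
    obtain ⟨P, f, hP, hf, hc⟩ := hPc X
    let S := ShortComplex.mk _ _ (kernel.condition f)
    have hS : S.ShortExact := { exact := ShortComplex.exact_kernel f }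
    have i1 : Subsingleton (Ext S.X₂ Y (n + 1)) := Ext.subsingleton_of_projective ..
    have i2 : Subsingleton (Ext (S.map F).X₂ (F.obj Y) (n + 1)) := h1 P n hc
    exact AddMonoidHom.bijective_of_surjective_of_bijective_of_right_exact _ _ _ _
      (F.mapExtAddHom S.X₂ Y n) (F.mapExtAddHom S.X₁ Y n) (F.mapExtAddHom S.X₃ Y (n + 1))
      (by cat_disch) (by cat_disch)
      ((ShortComplex.ab_exact_iff_function_exact _).1
        (Ext.contravariant_sequence_exact₁' hS Y n (n + 1) (add_comm 1 n)))
      ((ShortComplex.ab_exact_iff_function_exact _).1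
        (Ext.contravariant_sequence_exact₁' (hS.map F) (F.obj Y) n (n + 1) (add_comm 1 n)))
      (hn _).surjective (hn _)
      (fun x => by
        obtain ⟨y, hy⟩ := Ext.contravariant_sequence_exact₃ hS Y x (Subsingleton.elim _ _) (add_comm 1 n)
        exact ⟨y, hy⟩)
      (fun x => by
        obtain ⟨y, hy⟩ := Ext.contravariant_sequence_exact₃ (hS.map F) (F.obj Y) x (Subsingleton.elim _ _) (add_comm 1 n)
        exact ⟨y, hy⟩)
end ExtMap

section OldNew
open Abelian
variable (R : Type) [CommRing R] (X Y : ModuleCat.{0} R)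

/-- two surjections with the same kernel -/
lemma addEquiv_of_surj {G H K : Type*} [AddCommGroup G] [AddCommGroup H] [AddCommGroup K]
    (f : G →+ H) (g : G →+ K) (hf : Function.Surjective f) (hg : Function.Surjective g)
    (h : ∀ x, f x = 0 ↔ g x = 0) : Nonempty (H ≃+ K) := by
  have : f.ker = g.ker := by ext x; exact h x
  exact ⟨(QuotientAddGroup.quotientKerEquivOfSurjective f hf).symm.trans
    ((QuotientAddGroup.quotientAddEquivOfEq this).trans
      (QuotientAddGroup.quotientKerEquivOfSurjective g hg))⟩

variable {R X Y}
/-- cocycles -/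
def cocyc (P : ProjectiveResolution X) (Y : ModuleCat.{0} R) (n : ℕ) : AddSubgroup (P.complex.X n ⟶ Y) where
  carrier := {f | P.complex.d (n+1) n ≫ f = 0}
  add_mem' := by intro a b ha hb; simp_all
  zero_mem' := by simp
  neg_mem' := by intro a ha; simp_all

def toNew (P : ProjectiveResolution X) (Y : ModuleCat.{0} R) (n : ℕ) : cocyc P Y n →+ Abelian.Ext X Y n :=
  AddMonoidHom.mk' (fun f => P.extMk f.1 (n+1) rfl f.2) (by
    intro f g; exact (P.add_extMk ..).symm)

lemma old_equiv (P : ProjectiveResolution X) (n : ℕ) :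
   ∃ f : cocyc P Y n →+ (((_root_.Ext R (ModuleCat R) n).obj (Opposite.op X)).obj Y), Function.Surjective f ∧
     ∀ x, f x = 0 ↔ (x.1 = 0 ∨ ∃ m, m + 1 = n ∧ ∃ g : P.complex.X m ⟶ Y, P.complex.d n m ≫ g = x.1) := by
  let K := P.complex.linearYonedaObj R Y
  let e := (P.isoExt (R := R) n Y).toLinearEquiv
  let S := K.sc n
  have key : ∃ f : cocyc P Y n →+ (S.homology), Function.Surjective f ∧
     ∀ x, f x = 0 ↔ (x.1 = 0 ∨ ∃ m, m + 1 = n ∧ ∃ g : P.complex.X m ⟶ Y, P.complex.d n m ≫ g = x.1) := by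
    let e' := (S.moduleCatHomologyIso).toLinearEquiv
    have hg : ∀ x : P.complex.X n ⟶ Y, S.g.hom x = 0 ↔ P.complex.d (n+1) n ≫ x = 0 := by
      intro x
      have h1 : (ComplexShape.up ℕ).next n = n + 1 := by simp
      change (K.d n _).hom x = 0 ↔ _
      rw [h1]
      rfl
    let f0 : cocyc P Y n →+ S.moduleCatLeftHomologyData.H :=
      AddMonoidHom.mk' (fun x => Submodule.Quotient.mk (⟨x.1, (hg x.1).2 x.2⟩ : LinearMap.ker S.g.hom)) (by
        intro a b; rfl)
    refine ⟨e'.symm.toAddEquiv.toAddMonoidHom.comp f0, e'.symm.surjective.comp ?_, fun x => ?_⟩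
    · intro y
      obtain ⟨⟨x, hx⟩, rfl⟩ := Submodule.Quotient.mk_surjective _ y
      exact ⟨⟨x, (hg x).1 hx⟩, rfl⟩
    · refine Iff.trans (e'.symm.map_eq_zero_iff) ?_
      refine Iff.trans (Submodule.Quotient.mk_eq_zero _) ?_
      have hx : (⟨x.1, (hg x.1).2 x.2⟩ : LinearMap.ker S.g.hom) ∈ LinearMap.range S.moduleCatToCycles ↔
          ∃ y, S.f.hom y = x.1 := by
        constructor
        · rintro ⟨y, hy⟩
          exact ⟨y, congrArg Subtype.val hy⟩
        · rintro ⟨y, hy⟩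
          exact ⟨y, Subtype.ext hy⟩
      refine hx.trans ?_
      change (∃ y, (K.d ((ComplexShape.up ℕ).prev n) n).hom y = x.1) ↔ _
      obtain _ | m := n
      · constructor
        · rintro ⟨y, hy⟩
          left
          rw [K.shape _ _ (by simp)] at hy
          exact hy.symm
        · rintro (hy | ⟨m, hm, _⟩)
          · exact ⟨0, by rw [hy]; exact map_zero _⟩
          · omega
      · have h1 : (ComplexShape.up ℕ).prev (m+1) = m := by simp
        rw [h1]
        constructor
        · rintro ⟨y, hy⟩
          exact Or.inr ⟨m, rfl, y, hy⟩
        · rintro (hy | ⟨m', hm, y, hy⟩)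
          · exact ⟨0, by rw [hy]; exact map_zero _⟩
          · obtain rfl : m' = m := by omega
            exact ⟨y, hy⟩
  obtain ⟨f, hf, h⟩ := key
  exact ⟨(e.symm.toAddEquiv.toAddMonoidHom).comp f, e.symm.surjective.comp hf, fun x => by
    rw [← h]; exact e.symm.map_eq_zero_iff⟩

lemma old_new (n : ℕ) : Nonempty ((((_root_.Ext R (ModuleCat R) (n+1)).obj (Opposite.op X)).obj Y)
   ≃+ Abelian.Ext X Y (n+1)) := by
  obtain ⟨P⟩ : Nonempty (ProjectiveResolution X) := ⟨projectiveResolution X⟩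
  obtain ⟨f, hf, h⟩ := old_equiv (Y := Y) P (n+1)
  refine addEquiv_of_surj f (toNew P Y (n+1)) hf ?_ ?_
  · intro α
    obtain ⟨g, hg, e⟩ := P.extMk_surjective α _ rfl
    exact ⟨⟨g, hg⟩, e⟩
  · intro x
    rw [h]
    have := P.extMk_eq_zero_iff x.1 (n+2) rfl x.2 n rfl
    refine Iff.trans ?_ this.symm
    constructor
    · rintro (h0 | ⟨m, hm, g, hg⟩)
      · exact ⟨0, by rw [h0, comp_zero]⟩
      obtain rfl : m = n := by omega
      exact ⟨g, hg⟩
    · rintro ⟨g, hg⟩; exact Or.inr ⟨n, rfl, g, hg⟩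

lemma old_zero : Nonempty ((((_root_.Ext R (ModuleCat R) 0).obj (Opposite.op X)).obj Y)
   ≃+ (X ⟶ Y)) := by
  obtain ⟨P⟩ : Nonempty (ProjectiveResolution X) := ⟨projectiveResolution X⟩
  obtain ⟨f, hf, h⟩ := old_equiv (Y := Y) P 0
  have ex := P.exact₀
  have hepi : Epi (ShortComplex.mk _ _ P.complex_d_comp_π_f_zero).g := inferInstanceAs (Epi (P.π.f 0))
  let g : (X ⟶ Y) →+ cocyc P Y 0 := AddMonoidHom.mk' (fun u => ⟨P.π.f 0 ≫ (HomologicalComplex.singleObjXSelf (.down ℕ) 0 X).hom ≫ u, by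
      show _ ≫ _ = 0
      rw [← Category.assoc, P.complex_d_comp_π_f_zero, zero_comp]⟩) (by
        intro a b; ext1
        show _ ≫ _ ≫ (a + b) = _ ≫ _ ≫ a + _ ≫ _ ≫ b
        rw [Preadditive.comp_add, Preadditive.comp_add])
  have hb : Function.Bijective (f.comp g) := by
    constructor
    · rw [injective_iff_map_eq_zero]
      intro u hu
      obtain hu | ⟨m, hm, _⟩ := (h _).1 hu
      · have hu : P.π.f 0 ≫ (HomologicalComplex.singleObjXSelf (.down ℕ) 0 X).hom ≫ u = 0 := hu
        rw [← cancel_epi (HomologicalComplex.singleObjXSelf (.down ℕ) 0 X).hom, comp_zero]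
        have : Epi (P.π.f 0) := hepi
        rw [← cancel_epi (P.π.f 0), hu, comp_zero]
      · omega
    · intro y
      obtain ⟨x, rfl⟩ := hf y
      have hx : P.complex.d 1 0 ≫ x.1 = 0 := x.2
      refine ⟨(HomologicalComplex.singleObjXSelf (.down ℕ) 0 X).inv ≫ ex.desc x.1 hx, ?_⟩
      show f _ = _
      congr 1
      ext1
      show P.π.f 0 ≫ (HomologicalComplex.singleObjXSelf (.down ℕ) 0 X).hom ≫ (HomologicalComplex.singleObjXSelf (.down ℕ) 0 X).inv ≫ ex.desc x.1 hx = _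
      rw [Iso.hom_inv_id_assoc]
      exact ex.g_desc x.1 hx
  exact ⟨(AddEquiv.ofBijective _ hb).symm⟩
end OldNew
end HCC
end

noncomputable section
open CategoryTheory Limits
namespace HCC
section Compare
variable {R S : Type} [CommRing R] [CommRing S] (φ : R →+* S)

lemma ext_compare (X Y : ModuleCat.{0} S)
    (H1 : ∀ (Z : ModuleCat.{0} S) (f : Z → Y), (∀ x y, f (x + y) = f x + f y) →
      (∀ (c : R) x, f (φ c • x) = φ c • f x) → ∀ (c : S) x, f (c • x) = c • f x)
    (H2 : ∀ (W : Type) (n : ℕ), Subsingleton (Abelian.Ext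
      ((ModuleCat.restrictScalars φ).obj (ModuleCat.of S (W →₀ S)))
      ((ModuleCat.restrictScalars φ).obj Y) (n+1)))
    (X' Y' : ModuleCat.{0} R) (eX : (ModuleCat.restrictScalars φ).obj X ≅ X')
    (eY : (ModuleCat.restrictScalars φ).obj Y ≅ Y') (n : ℕ) :
    Nonempty ((((_root_.Ext R (ModuleCat R) n).obj (Opposite.op X')).obj Y') ≃+
      (((_root_.Ext S (ModuleCat S) n).obj (Opposite.op X)).obj Y)) := by
  let F := ModuleCat.restrictScalars.{0} φ
  have h0 : ∀ Z : ModuleCat.{0} S, Function.Bijective (fun f : Z ⟶ Y => F.map f) := by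
    intro Z
    refine ⟨fun f g h => F.map_injective h, fun g => ?_⟩
    refine ⟨ModuleCat.ofHom
      { toFun := fun z => g.hom z
        map_add' := fun x y => g.hom.map_add x y
        map_smul' := H1 Z (fun z => g.hom z) (fun x y => g.hom.map_add x y)
          (fun c x => g.hom.map_smul c x) }, ?_⟩
    ext x
    rfl
  let e0 : ((((_root_.Ext R (ModuleCat R) n).obj (Opposite.op X')).obj Y')) ≃+
      (((_root_.Ext R (ModuleCat R) n).obj (Opposite.op (F.obj X))).obj (F.obj Y)) :=
    ((((_root_.Ext R (ModuleCat R) n).mapIso eX.op).app Y').toLinearEquiv.trans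
      (((_root_.Ext R (ModuleCat R) n).obj (Opposite.op (F.obj X))).mapIso eY).symm.toLinearEquiv).toAddEquiv
  suffices Nonempty ((((_root_.Ext R (ModuleCat R) n).obj (Opposite.op (F.obj X))).obj (F.obj Y)) ≃+
      (((_root_.Ext S (ModuleCat S) n).obj (Opposite.op X)).obj Y)) from ⟨e0.trans this.some⟩
  obtain _ | n := n
  · obtain ⟨a⟩ := old_zero (X := F.obj X) (Y := F.obj Y)
    obtain ⟨b⟩ := old_zero (X := X) (Y := Y)
    have : Function.Bijective (F.mapAddHom : (X ⟶ Y) →+ _) := h0 X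
    exact ⟨a.trans ((AddEquiv.ofBijective _ this).symm.trans b.symm)⟩
  · obtain ⟨a⟩ := old_new (X := F.obj X) (Y := F.obj Y) n
    obtain ⟨b⟩ := old_new (X := X) (Y := Y) n
    have := mapExt_bijective F (fun P => ∃ W : Type, P = ModuleCat.of S (W →₀ S)) (by
      intro X
      refine ⟨ModuleCat.of S (X →₀ S), ModuleCat.ofHom (Finsupp.linearCombination S (id : X → X)), ?_, ?_, _, rfl⟩
      · exact ModuleCat.projective_of_free Finsupp.basisSingleOne
      · rw [ModuleCat.epi_iff_surjective]
        exact Finsupp.linearCombination_surjective _ Function.surjective_id) Y h0 (by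
        rintro P n ⟨W, rfl⟩
        exact H2 W n) X (n+1)
    exact ⟨a.trans ((AddEquiv.ofBijective _ this).symm.trans b.symm)⟩
end Compare
end HCC
end

noncomputable section
open CategoryTheory Limits
namespace HCC
section Flatness

lemma flat_ker {A : Type} [CommRing A] {K P N : Type} [AddCommGroup K] [AddCommGroup P] [AddCommGroup N]
    [Module A K] [Module A P] [Module A N] (i : K →ₗ[A] P) (p : P →ₗ[A] N)
    (hi : Function.Injective i) (hp : Function.Surjective p) (hip : Function.Exact i p)
    [Module.Flat A P] [Module.Flat A N] : Module.Flat A K := by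
  rw [Module.Flat.iff_rTensor_preserves_injective_linearMap]
  intro M M' _ _ _ _ f hf
  have h1 := LinearMap.lTensor_injective_of_exact_of_flat p hp i hi hip M
  have h2 := Module.Flat.rTensor_preserves_injective_linearMap (M := P) f hf
  have h3 : (i.lTensor M') ∘ₗ (f.rTensor K) = (f.rTensor P) ∘ₗ (i.lTensor M) := by
    rw [LinearMap.lTensor_comp_rTensor, LinearMap.rTensor_comp_lTensor]
  have h4 : Function.Injective ((i.lTensor M') ∘ₗ (f.rTensor K)) := by
    rw [h3]
    exact h2.comp h1
  exact Function.Injective.of_comp (f := i.lTensor M') h4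

/-- flatness via a ring map -/
def FlatVia {A C : Type} [CommRing A] [CommRing C] (f : A →+* C) (X : Type) [AddCommGroup X] [Module C X] : Prop :=
  @Module.Flat A X _ _ (Module.compHom X f)

variable {A C : Type} [CommRing A] [CommRing C]
variable {K P N : Type} [AddCommGroup K] [AddCommGroup P] [AddCommGroup N] [Module C K] [Module C P] [Module C N]

lemma FlatVia.rel {f : A →+* C} (h : FlatVia f N) {ι : Type} [Fintype ι] (c : ι → A) (x : ι → N)
    (hx : ∑ j, f (c j) • x j = 0) : ∃ (k : ℕ) (b : ι → Fin k → A) (y : Fin k → N),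
      (∀ j, x j = ∑ t, f (b j t) • y t) ∧ ∀ t, ∑ j, c j * b j t = 0 := by
  let : Module A N := Module.compHom N f
  have : Module.Flat A N := h
  exact Module.Flat.isTrivialRelation_of_sum_smul_eq_zero (R := A) (M := N) (f := c) (x := x) hx

lemma FlatVia.of_rel {f : A →+* C} (h : ∀ (n : ℕ) (c : Fin n → A) (x : Fin n → N),
    (∑ j, f (c j) • x j = 0) → ∃ (k : ℕ) (b : Fin n → Fin k → A) (y : Fin k → N),
      (∀ j, x j = ∑ t, f (b j t) • y t) ∧ ∀ t, ∑ j, c j * b j t = 0) : FlatVia f N := by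
  let : Module A N := Module.compHom N f
  show Module.Flat A N
  refine Module.Flat.of_forall_isTrivialRelation ?_
  intro n c x hx
  exact h n c x hx

lemma flatVia_ker (f : A →+* C) (i : K →ₗ[C] P) (p : P →ₗ[C] N)
    (hi : Function.Injective i) (hp : Function.Surjective p) (hip : Function.Exact i p)
    (h1 : FlatVia f P) (h2 : FlatVia f N) : FlatVia f K := by
  let : Module A N := Module.compHom N f
  let : Module A P := Module.compHom P f
  let : Module A K := Module.compHom K f
  have : Module.Flat A N := h2
  have : Module.Flat A P := h1
  let i' : K →ₗ[A] P := { toFun := i, map_add' := i.map_add, map_smul' := fun c x => i.map_smul (f c) x }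
  let p' : P →ₗ[A] N := { toFun := p, map_add' := p.map_add, map_smul' := fun c x => p.map_smul (f c) x }
  exact flat_ker i' p' hi hp hip

lemma FlatVia.of_equiv {f : A →+* C} (e : P ≃ₗ[C] N) (h : FlatVia f N) : FlatVia f P := by
  let : Module A N := Module.compHom N f
  let : Module A P := Module.compHom P f
  have : Module.Flat A N := h
  let e' : P ≃ₗ[A] N := { e with map_smul' := fun c x => e.map_smul (f c) x }
  exact Module.Flat.of_linearEquiv e'

lemma FlatVia.finsupp {f : A →+* C} (h : FlatVia f N) (S : Type) : FlatVia f (S →₀ N) := by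
  let : Module A N := Module.compHom N f
  have : Module.Flat A N := h
  have : Module.Flat A (S →₀ N) := by
    classical
    exact Module.Flat.of_linearEquiv (finsuppLequivDFinsupp A : (S →₀ N) ≃ₗ[A] _)
  exact this

lemma mem_map_smul_top (f : A →+* C) (J : Ideal A) (x : N) :
    x ∈ ((J.map f) • ⊤ : Submodule C N) ↔ ∃ (n : ℕ) (c : Fin n → A) (y : Fin n → N), (∀ j, c j ∈ J) ∧
      x = ∑ j, f (c j) • y j := by
  constructor
  · intro hx
    refine Submodule.smul_induction_on hx ?_ ?_
    · intro r hr m _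
      refine Submodule.span_induction (p := fun r _ => ∃ (n : ℕ) (c : Fin n → A) (y : Fin n → N), (∀ j, c j ∈ J) ∧ r • m = ∑ j, f (c j) • y j) ?_ ?_ ?_ ?_ hr
      · rintro _ ⟨c, hc, rfl⟩
        exact ⟨1, fun _ => c, fun _ => m, fun _ => hc, by simp⟩
      · exact ⟨0, fun _ => 0, fun _ => 0, fun j => J.zero_mem, by simp⟩
      · rintro r s _ _ ⟨n, c, y, h, e⟩ ⟨n', c', y', h', e'⟩
        refine ⟨n + n', Fin.append c c', Fin.append y y', fun j => ?_, ?_⟩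
        · refine Fin.addCases (fun j => ?_) (fun j => ?_) j <;> simp [h, h']
        · simp [Fin.sum_univ_add, add_smul, e, e']
      · rintro r s _ ⟨n, c, y, h, e⟩
        refine ⟨n, c, fun j => r • y j, h, ?_⟩
        rw [smul_eq_mul, mul_smul, e, Finset.smul_sum]
        exact Finset.sum_congr rfl fun j _ => smul_comm _ _ _
    · rintro x x' ⟨n, c, y, h, rfl⟩ ⟨n', c', y', h', rfl⟩
      refine ⟨n + n', Fin.append c c', Fin.append y y', fun j => ?_, ?_⟩
      · refine Fin.addCases (fun j => ?_) (fun j => ?_) j <;> simp [h, h']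
      · simp [Fin.sum_univ_add]
  · rintro ⟨n, c, y, h, rfl⟩
    exact Submodule.sum_mem _ fun j _ => Submodule.smul_mem_smul (Ideal.mem_map_of_mem _ (h j)) trivial

lemma flatVia_pure (f : A →+* C) (i : K →ₗ[C] P) (p : P →ₗ[C] N)
    (hi : Function.Injective i) (hp : Function.Surjective p) (hip : Function.Exact i p)
    (h2 : FlatVia f N) (J : Ideal A) (x : K) (hx : i x ∈ ((J.map f) • ⊤ : Submodule C P)) :
    x ∈ ((J.map f) • ⊤ : Submodule C K) := by
  obtain ⟨n, c, y, hc, e⟩ := (mem_map_smul_top f J _).1 hx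
  have h0 : ∑ j, f (c j) • p (y j) = 0 := by
    have := congrArg p e
    rw [hip.apply_apply_eq_zero, map_sum] at this
    simpa using this.symm
  obtain ⟨k, b, z, h1, h2⟩ := h2.rel c _ h0
  choose w hw using fun t => hp (z t)
  have : ∀ j, ∃ u, i u = y j - ∑ t, f (b j t) • w t := fun j => by
    refine (hip _).1 ?_
    simp [h1, hw]
  choose u hu using this
  refine (mem_map_smul_top f J _).2 ⟨n, c, u, hc, hi ?_⟩
  rw [map_sum]
  simp only [map_smul, hu, smul_sub, Finset.sum_sub_distrib]
  rw [← e]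
  simp only [Finset.smul_sum, ← mul_smul, ← map_mul]
  rw [Finset.sum_comm]
  simp only [← Finset.sum_smul, ← map_sum, h2]
  simp
end Flatness
end HCC
end

noncomputable section
open CategoryTheory Limits
namespace HCC
section Lifting
variable {C : Type} [CommRing C] (I : Ideal C)
variable {K P M : Type} [AddCommGroup K] [AddCommGroup P] [AddCommGroup M] [Module C K] [Module C P] [Module C M]

lemma lift_step [Module.Projective C P] (i : K →ₗ[C] P) (ρ : P →ₗ[C] (K ⧸ (I • ⊤ : Submodule C K)))
    (hρ : ∀ x, ρ (i x) = Submodule.Quotient.mk x) (n : ℕ) (g : K →ₗ[C] M)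
    (hg : ∀ x, g x ∈ (I ^ n • ⊤ : Submodule C M)) :
    ∃ h : P →ₗ[C] M, (∀ x, h x ∈ (I ^ n • ⊤ : Submodule C M)) ∧
      ∀ x, g x - h (i x) ∈ (I ^ (n+1) • ⊤ : Submodule C M) := by
  let N : Submodule C M := I ^ n • ⊤
  let g' : K →ₗ[C] N := g.codRestrict N hg
  let q : (K ⧸ (I • ⊤ : Submodule C K)) →ₗ[C] (N ⧸ (I • ⊤ : Submodule C N)) :=
    Submodule.mapQ _ _ g' (by
      rw [← Submodule.map_le_iff_le_comap, Submodule.map_smul'']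
      exact Submodule.smul_mono le_rfl le_top)
  obtain ⟨h, hh⟩ := Module.projective_lifting_property (Submodule.mkQ (I • ⊤ : Submodule C N)) (q ∘ₗ ρ)
    (Submodule.mkQ_surjective _)
  refine ⟨N.subtype ∘ₗ h, fun x => (h x).2, fun x => ?_⟩
  have h1 : g' x - h (i x) ∈ (I • ⊤ : Submodule C N) := by
    rw [← Submodule.Quotient.mk_eq_zero, Submodule.Quotient.mk_sub, sub_eq_zero]
    have := LinearMap.congr_fun hh (i x)
    simp only [LinearMap.comp_apply, hρ, Submodule.mkQ_apply] at this
    rw [this]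
    rfl
  have h2 := Submodule.mem_map_of_mem (f := N.subtype) h1
  rw [Submodule.map_smul'', Submodule.map_top, Submodule.range_subtype, ← mul_smul, ← pow_succ'] at h2
  exact h2

lemma extend_complete [Module.Projective C P] [IsAdicComplete I M] (i : K →ₗ[C] P)
    (ρ : P →ₗ[C] (K ⧸ (I • ⊤ : Submodule C K)))
    (hρ : ∀ x, ρ (i x) = Submodule.Quotient.mk x) (f : K →ₗ[C] M) :
    ∃ g : P →ₗ[C] M, ∀ x, g (i x) = f x := by
  have step : ∀ n (S : {S : P →ₗ[C] M // ∀ x, f x - S (i x) ∈ (I ^ n • ⊤ : Submodule C M)}),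
      ∃ S' : {S : P →ₗ[C] M // ∀ x, f x - S (i x) ∈ (I ^ (n+1) • ⊤ : Submodule C M)},
        ∀ x, S'.1 x - S.1 x ∈ (I ^ n • ⊤ : Submodule C M) := by
    rintro n ⟨S, hS⟩
    obtain ⟨h, h1, h2⟩ := lift_step I i ρ hρ n (f - S ∘ₗ i) hS
    refine ⟨⟨S + h, fun x => ?_⟩, fun x => ?_⟩
    · have := h2 x
      simp only [LinearMap.sub_apply, LinearMap.comp_apply, LinearMap.add_apply] at this ⊢
      rwa [← sub_sub]
    · simpa using h1 x
  choose nx hnx using step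
  let S : ∀ n, {S : P →ₗ[C] M // ∀ x, f x - S (i x) ∈ (I ^ n • ⊤ : Submodule C M)} := fun n =>
    Nat.rec ⟨0, fun x => by simp⟩ (fun n S => nx n S) n
  have hS : ∀ n x, (S (n+1)).1 x - (S n).1 x ∈ (I ^ n • ⊤ : Submodule C M) := fun n x => hnx n (S n) x
  have hS' : ∀ m n, m ≤ n → ∀ x, (S n).1 x - (S m).1 x ∈ (I ^ m • ⊤ : Submodule C M) := by
    intro m n hmn x
    induction n, hmn using Nat.le_induction with
    | base => simp
    | succ n hmn ih =>
      rw [← sub_add_sub_cancel _ ((S n).1 x)]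
      exact Submodule.add_mem _ (Submodule.pow_smul_top_le I M hmn (hS n x)) ih
  let T : ∀ n, P →ₗ[C] (M ⧸ (I ^ n • ⊤ : Submodule C M)) := fun n => Submodule.mkQ _ ∘ₗ (S n).1
  have hT : ∀ {m n : ℕ} (hle : m ≤ n), Submodule.factorPow I M hle ∘ₗ T n = T m := by
    intro m n hle
    ext x
    show Submodule.factorPow I M hle (Submodule.Quotient.mk ((S n).1 x)) = Submodule.Quotient.mk ((S m).1 x)
    refine Eq.trans (b := Submodule.Quotient.mk ((S n).1 x)) rfl ?_
    rw [Submodule.Quotient.eq]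
    exact hS' m n hle x
  refine ⟨IsAdicComplete.lift I T hT, fun x => ?_⟩
  rw [← sub_eq_zero]
  refine IsHausdorff.haus (inferInstance : IsHausdorff I M) _ fun n => ?_
  rw [SModEq.zero, ← Submodule.Quotient.eq]
  refine (IsAdicComplete.mk_lift I hT n (i x)).trans ?_
  refine Eq.trans (b := Submodule.Quotient.mk ((S n).1 (i x))) rfl ?_
  rw [eq_comm, Submodule.Quotient.eq]
  exact (S n).2 x
end Lifting
end HCC
end

noncomputable section
open CategoryTheory Limits
namespace HCC
section GoodSec
variable {A C : Type} [CommRing A] [CommRing C]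

structure Good (l r : A →+* C) (a : Ideal A) (X : Type) [AddCommGroup X] [Module C X] : Prop where
  flat1 : FlatVia l X
  flat2 : FlatVia r (X ⧸ (a.map l • ⊤ : Submodule C X))
  lift : ∀ (N N' : Type) [AddCommGroup N] [AddCommGroup N'] [Module C N] [Module C N']
    (g : N →ₗ[C] N'), Function.Surjective g → (∀ c ∈ a.map l + a.map r, ∀ x : N, c • x = 0) →
    ∀ h : X →ₗ[C] N', ∃ h' : X →ₗ[C] N, ∀ x, g (h' x) = h x

variable {l r : A →+* C} {a : Ideal A}
variable {K P X : Type} [AddCommGroup K] [AddCommGroup P] [AddCommGroup X] [Module C K] [Module C P] [Module C X]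

/-- induced map on quotients -/
def quotMap (J : Ideal C) (f : K →ₗ[C] P) :
    (K ⧸ (J • ⊤ : Submodule C K)) →ₗ[C] (P ⧸ (J • ⊤ : Submodule C P)) :=
  Submodule.mapQ _ _ f (by
      rw [← Submodule.map_le_iff_le_comap, Submodule.map_smul'']
      exact Submodule.smul_mono le_rfl le_top)

@[simp] lemma quotMap_mk (J : Ideal C) (f : K →ₗ[C] P) (x : K) :
    quotMap J f (Submodule.Quotient.mk x) = Submodule.Quotient.mk (f x) := rfl

lemma quotMap_surj (J : Ideal C) (f : K →ₗ[C] P) (hf : Function.Surjective f) :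
    Function.Surjective (quotMap J f) := by
  intro y
  obtain ⟨y, rfl⟩ := Submodule.Quotient.mk_surjective _ y
  obtain ⟨x, rfl⟩ := hf y
  exact ⟨Submodule.Quotient.mk x, rfl⟩

lemma quotMap_exact (J : Ideal C) (i : K →ₗ[C] P) (p : P →ₗ[C] X)
    (hp : Function.Surjective p) (hip : Function.Exact i p) :
    Function.Exact (quotMap J i) (quotMap J p) := by
  intro y
  obtain ⟨y, rfl⟩ := Submodule.Quotient.mk_surjective _ y
  constructor
  · intro h
    rw [quotMap_mk, Submodule.Quotient.mk_eq_zero] at h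
    have h' : p y ∈ Submodule.map p (J • ⊤ : Submodule C P) := by
      rwa [Submodule.map_smul'', Submodule.map_top, LinearMap.range_eq_top.2 hp]
    obtain ⟨z, hz, e⟩ := h'
    obtain ⟨x, hx⟩ := (hip (y - z)).1 (by rw [map_sub, e, sub_self])
    refine ⟨Submodule.Quotient.mk x, ?_⟩
    rw [quotMap_mk, Submodule.Quotient.eq, hx]
    rw [sub_sub_cancel_left]
    exact Submodule.neg_mem _ hz
  · rintro ⟨x, hx⟩
    obtain ⟨x, rfl⟩ := Submodule.Quotient.mk_surjective _ x
    rw [← hx, quotMap_mk, quotMap_mk, hip.apply_apply_eq_zero]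
    rfl

lemma quotMap_inj (J : Ideal C) (f : K →ₗ[C] P)
    (hf : ∀ x, f x ∈ (J • ⊤ : Submodule C P) → x ∈ (J • ⊤ : Submodule C K)) :
    Function.Injective (quotMap J f) := by
  rw [injective_iff_map_eq_zero]
  intro y hy
  obtain ⟨y, rfl⟩ := Submodule.Quotient.mk_surjective _ y
  rw [quotMap_mk, Submodule.Quotient.mk_eq_zero] at hy
  rw [Submodule.Quotient.mk_eq_zero]
  exact hf _ hy

lemma mem_two_step (J J' : Ideal C) (x : X) : x ∈ ((J + J') • ⊤ : Submodule C X) ↔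
    (Submodule.Quotient.mk x : X ⧸ (J • ⊤ : Submodule C X)) ∈ (J' • ⊤ : Submodule C (X ⧸ (J • ⊤ : Submodule C X))) := by
  have h : (J' • ⊤ : Submodule C (X ⧸ (J • ⊤ : Submodule C X))) =
      Submodule.map (Submodule.mkQ (J • ⊤ : Submodule C X)) (J' • ⊤) := by
    rw [Submodule.map_smul'', Submodule.map_top, Submodule.range_mkQ]
  rw [h]
  have h2 : (Submodule.Quotient.mk x : X ⧸ (J • ⊤ : Submodule C X)) ∈
      Submodule.map (Submodule.mkQ (J • ⊤ : Submodule C X)) (J' • ⊤) ↔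
      x ∈ Submodule.comap (Submodule.mkQ (J • ⊤ : Submodule C X)) (Submodule.map (Submodule.mkQ (J • ⊤ : Submodule C X)) (J' • ⊤)) := Iff.rfl
  rw [h2, Submodule.comap_map_mkQ, Submodule.add_eq_sup, Submodule.sup_smul]

lemma Good.rho [Module.Projective C P] (hX : Good l r a X) (i : K →ₗ[C] P) (p : P →ₗ[C] X)
    (hi : Function.Injective i) (hp : Function.Surjective p) (hip : Function.Exact i p) :
    Function.Injective (quotMap (a.map l) i) ∧
    ∃ ρ : P →ₗ[C] (K ⧸ ((a.map l + a.map r) • ⊤ : Submodule C K)), ∀ x, ρ (i x) = Submodule.Quotient.mk x := by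
  have h1 : Function.Injective (quotMap (a.map l) i) :=
    quotMap_inj _ _ fun x hx => flatVia_pure l i p hi hp hip hX.flat1 a x hx
  refine ⟨h1, ?_⟩
  set I := a.map l + a.map r with hI
  have h2 : Function.Injective (quotMap I i) := by
    refine quotMap_inj _ _ fun x hx => ?_
    rw [mem_two_step] at hx ⊢
    exact flatVia_pure r (quotMap (a.map l) i) (quotMap (a.map l) p) h1 (quotMap_surj _ _ hp)
      (quotMap_exact _ _ _ hp hip) hX.flat2 a _ hx
  obtain ⟨σ, hσ⟩ := hX.lift _ _ (quotMap I p) (quotMap_surj _ _ hp) (by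
    intro c hc x
    obtain ⟨x, rfl⟩ := Submodule.Quotient.mk_surjective _ x
    rw [← Submodule.Quotient.mk_smul, Submodule.Quotient.mk_eq_zero]
    exact Submodule.smul_mem_smul hc trivial) (Submodule.mkQ _)
  let d : P →ₗ[C] (P ⧸ (I • ⊤ : Submodule C P)) := Submodule.mkQ _ - σ ∘ₗ p
  have hd : ∀ y, d y ∈ LinearMap.range (quotMap I i) := by
    intro y
    refine (quotMap_exact I i p hp hip (d y)).1 ?_
    show quotMap I p (Submodule.Quotient.mk y - σ (p y)) = 0
    rw [map_sub, hσ, quotMap_mk]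
    exact sub_self _
  refine ⟨(LinearEquiv.ofInjective _ h2).symm.toLinearMap ∘ₗ d.codRestrict _ hd, fun x => ?_⟩
  apply (LinearEquiv.ofInjective _ h2).injective
  show (LinearEquiv.ofInjective _ h2) ((LinearEquiv.ofInjective _ h2).symm _) = _
  rw [LinearEquiv.apply_symm_apply]
  ext
  show Submodule.Quotient.mk (i x) - σ (p (i x)) = Submodule.Quotient.mk (i x)
  rw [hip.apply_apply_eq_zero, map_zero, sub_zero]

lemma Good.ker [Module.Projective C P] (hP : Good l r a P) (hX : Good l r a X) (i : K →ₗ[C] P) (p : P →ₗ[C] X)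
    (hi : Function.Injective i) (hp : Function.Surjective p) (hip : Function.Exact i p) :
    Good l r a K := by
  obtain ⟨h1, ρ, hρ⟩ := hX.rho i p hi hp hip
  refine ⟨flatVia_ker l i p hi hp hip hP.flat1 hX.flat1,
    flatVia_ker r _ _ h1 (quotMap_surj _ _ hp) (quotMap_exact _ _ _ hp hip) hP.flat2 hX.flat2, ?_⟩
  intro N N' _ _ _ _ g hg hN h
  let hbar : (K ⧸ ((a.map l + a.map r) • ⊤ : Submodule C K)) →ₗ[C] N' := Submodule.liftQ _ h (by
    rw [Submodule.smul_le]
    intro c hc x _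
    obtain ⟨n, hn⟩ := hg (h x)
    rw [LinearMap.mem_ker, map_smul, ← hn, ← map_smul, hN c hc, map_zero])
  obtain ⟨q, hq⟩ := Module.projective_lifting_property g (hbar ∘ₗ ρ) hg
  refine ⟨q ∘ₗ i, fun x => ?_⟩
  have := LinearMap.congr_fun hq (i x)
  simp only [LinearMap.comp_apply, hρ] at this
  rw [LinearMap.comp_apply, this]
  rfl

lemma Good.finsupp (hX : Good l r a X) (S : Type) : Good l r a (S →₀ X) := by
  refine ⟨hX.flat1.finsupp S, ?_, ?_⟩
  · let J := a.map l
    let m : (S →₀ X) →ₗ[C] (S →₀ (X ⧸ (J • ⊤ : Submodule C X))) := Finsupp.mapRange.linearMap (Submodule.mkQ _)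
    have hm : Function.Surjective m := Finsupp.mapRange_surjective _ rfl (Submodule.mkQ_surjective _)
    have hk : LinearMap.ker m = (J • ⊤ : Submodule C (S →₀ X)) := by
      apply le_antisymm
      · intro v hv
        have hv' : ∀ s, v s ∈ (J • ⊤ : Submodule C X) := fun s => by
          have := DFunLike.congr_fun hv s
          rw [← Submodule.Quotient.mk_eq_zero]
          exact this
        rw [← Finsupp.sum_single v]
        refine Submodule.sum_mem _ fun s _ => ?_
        have : Submodule.map (Finsupp.lsingle s : X →ₗ[C] S →₀ X) (J • ⊤) ≤ (J • ⊤ : Submodule C (S →₀ X)) := by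
          rw [Submodule.map_smul'']
          exact Submodule.smul_mono le_rfl le_top
        exact this ⟨_, hv' s, rfl⟩
      · rw [Submodule.smul_le]
        intro c hc x _
        ext s
        show Submodule.Quotient.mk (c • x s) = (0 : X ⧸ (J • ⊤ : Submodule C X))
        rw [Submodule.Quotient.mk_eq_zero]
        exact Submodule.smul_mem_smul hc trivial
    refine FlatVia.of_equiv ?_ (hX.flat2.finsupp S)
    exact (Submodule.quotEquivOfEq _ _ hk.symm).trans (m.quotKerEquivOfSurjective hm)
  · intro N N' _ _ _ _ g hg hN h
    choose h' hh' using fun s => hX.lift N N' g hg hN (h ∘ₗ Finsupp.lsingle s)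
    refine ⟨Finsupp.lsum C h', fun x => ?_⟩
    have : g ∘ₗ (Finsupp.lsum C h') = h := by
      ext s x
      simpa using hh' s x
    exact LinearMap.congr_fun this x
end GoodSec

section GoodExt
open Abelian
variable {A C : Type} [CommRing A] [CommRing C] {l r : A →+* C} {a : Ideal A}

lemma Good.ext_vanish (hC : Good l r a C) (M : Type) [AddCommGroup M] [Module C M]
    [IsAdicComplete (a.map l + a.map r) M] (n : ℕ) (X : Type) [AddCommGroup X] [Module C X] (hX : Good l r a X) :
    Subsingleton (Ext (ModuleCat.of C X) (ModuleCat.of C M) (n+1)) := by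
  induction n generalizing X with
  | zero =>
    let p : (X →₀ C) →ₗ[C] X := Finsupp.linearCombination C (id : X → X)
    have hp : Function.Surjective p := Finsupp.linearCombination_surjective _ Function.surjective_id
    let i : (LinearMap.ker p) →ₗ[C] (X →₀ C) := (LinearMap.ker p).subtype
    have hip : Function.Exact i p := LinearMap.exact_subtype_ker_map p
    have hi : Function.Injective i := Subtype.val_injective
    obtain ⟨_, ρ, hρ⟩ := hX.rho (K := LinearMap.ker p) (P := X →₀ C) i p hi hp hip
    let f1 : ModuleCat.of C (LinearMap.ker p) ⟶ ModuleCat.of C (X →₀ C) := ModuleCat.ofHom i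
    let f2 : ModuleCat.of C (X →₀ C) ⟶ ModuleCat.of C X := ModuleCat.ofHom p
    let S : ShortComplex (ModuleCat.{0} C) := ShortComplex.mk f1 f2 (by
      refine ModuleCat.hom_ext (LinearMap.ext fun x => ?_)
      exact hip.apply_apply_eq_zero x)
    have hS : S.ShortExact :=
      { exact := (ShortComplex.ShortExact.moduleCat_exact_iff_function_exact S).2 hip
        mono_f := (ModuleCat.mono_iff_injective _).2 hi
        epi_g := (ModuleCat.epi_iff_surjective _).2 hp }
    have : Projective S.X₂ := ModuleCat.projective_of_free Finsupp.basisSingleOne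
    refine subsingleton_of_forall_eq 0 fun x => ?_
    obtain ⟨y, hy⟩ := Ext.contravariant_sequence_exact₃ hS (ModuleCat.of C M) x
      (Ext.eq_zero_of_projective _) (show 1 + 0 = 0 + 1 from rfl)
    obtain ⟨f, rfl⟩ := (Ext.mk₀_bijective S.X₁ (ModuleCat.of C M)).2 y
    obtain ⟨g, hg⟩ := extend_complete (a.map l + a.map r) i ρ hρ f.hom
    have : f = S.f ≫ ModuleCat.ofHom g := by
      ext x
      exact (hg x).symm
    rw [← hy, this, ← Ext.mk₀_comp_mk₀, hS.extClass_comp_assoc]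
  | succ n ih =>
    let p : (X →₀ C) →ₗ[C] X := Finsupp.linearCombination C (id : X → X)
    have hp : Function.Surjective p := Finsupp.linearCombination_surjective _ Function.surjective_id
    let i : (LinearMap.ker p) →ₗ[C] (X →₀ C) := (LinearMap.ker p).subtype
    have hip : Function.Exact i p := LinearMap.exact_subtype_ker_map p
    have hi : Function.Injective i := Subtype.val_injective
    have hK := (hC.finsupp X).ker (K := LinearMap.ker p) (P := X →₀ C) hX i p hi hp hip
    let f1 : ModuleCat.of C (LinearMap.ker p) ⟶ ModuleCat.of C (X →₀ C) := ModuleCat.ofHom i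
    let f2 : ModuleCat.of C (X →₀ C) ⟶ ModuleCat.of C X := ModuleCat.ofHom p
    let S : ShortComplex (ModuleCat.{0} C) := ShortComplex.mk f1 f2 (by
      refine ModuleCat.hom_ext (LinearMap.ext fun x => ?_)
      exact hip.apply_apply_eq_zero x)
    have hS : S.ShortExact :=
      { exact := (ShortComplex.ShortExact.moduleCat_exact_iff_function_exact S).2 hip
        mono_f := (ModuleCat.mono_iff_injective _).2 hi
        epi_g := (ModuleCat.epi_iff_surjective _).2 hp }
    have : Projective S.X₂ := ModuleCat.projective_of_free Finsupp.basisSingleOne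
    refine subsingleton_of_forall_eq 0 fun x => ?_
    obtain ⟨y, hy⟩ := Ext.contravariant_sequence_exact₃ hS (ModuleCat.of C M) x
      (Ext.eq_zero_of_projective _) (show 1 + (n+1) = n+1+1 by omega)
    have := ih _ hK
    have hy0 : y = 0 := Subsingleton.elim _ _
    rw [← hy, hy0, Ext.comp_zero]
end GoodExt
end HCC
end

noncomputable section
open scoped TensorProduct
namespace HCC
section TPSec
/-- abstract tensor product decomposition -/
def TP {A C : Type} [CommRing A] [CommRing C] (l r : A →+* C) : Prop :=
  ∀ p q : Ideal A, ∃ (W : Type) (b : W → A),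
    (∀ c, ∃ v : W →₀ A, c - v.sum (fun w x => l x * r (b w)) ∈ p.map l + q.map r) ∧
    (∀ v : W →₀ A, v.sum (fun w x => l x * r (b w)) ∈ p.map l + q.map r → ∀ w, v w ∈ p)

lemma TP.map {A C C' : Type} [CommRing A] [CommRing C] [CommRing C'] {l r : A →+* C} (h : TP l r)
    (e : C ≃+* C') : TP (e.toRingHom.comp l) (e.toRingHom.comp r) := by
  intro p q
  obtain ⟨W, b, h1, h2⟩ := h p q
  have key : p.map (e.toRingHom.comp l) + q.map (e.toRingHom.comp r) =
      (p.map l + q.map r).map e.toRingHom := by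
    rw [Submodule.add_eq_sup, Submodule.add_eq_sup, Ideal.map_sup, Ideal.map_map, Ideal.map_map]
  have hs : ∀ v : W →₀ A, v.sum (fun w x => e.toRingHom.comp l x * e.toRingHom.comp r (b w)) =
      e (v.sum (fun w x => l x * r (b w))) := by
    intro v
    simp [Finsupp.sum, map_sum]
  refine ⟨W, b, fun c => ?_, fun v hv => ?_⟩
  · obtain ⟨v, hv⟩ := h1 (e.symm c)
    refine ⟨v, ?_⟩
    rw [hs, key]
    have := Ideal.mem_map_of_mem e.toRingHom hv
    simpa using this
  · refine h2 v ?_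
    rw [hs, key] at hv
    have h3 := Ideal.mem_map_of_mem e.symm.toRingHom hv
    rw [Ideal.map_map] at h3
    simpa using h3

variable (k A : Type) [Field k] [CommRing A] [Algebra k A]

lemma tp_left : TP (Algebra.TensorProduct.includeLeftRingHom : A →+* A ⊗[k] A)
    ((Algebra.TensorProduct.includeRight (R := k) (A := A) (B := A)).toRingHom) := by
  intro p q
  let β := Module.Basis.ofVectorSpace k (A ⧸ q)
  choose b hb using fun w => Ideal.Quotient.mk_surjective (β w)
  refine ⟨_, b, fun c => ?_, fun v hv w => ?_⟩
  · induction c using TensorProduct.induction_on with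
    | zero => exact ⟨0, by simp⟩
    | add c c' h h' =>
      obtain ⟨v, hv⟩ := h
      obtain ⟨v', hv'⟩ := h'
      refine ⟨v + v', ?_⟩
      rw [Finsupp.sum_add_index' (by simp) (by intro w x y; rw [map_add, add_mul]), add_sub_add_comm]
      exact Ideal.add_mem _ hv hv'
    | tmul x y =>
      let s := β.repr (Ideal.Quotient.mk q y)
      have hy : y - ∑ w ∈ s.support, s w • b w ∈ q := by
        rw [← Ideal.Quotient.eq_zero_iff_mem, map_sub, map_sum]
        have h1 : ∀ w, Ideal.Quotient.mk q (s w • b w) = s w • β w := fun w => by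
          rw [← hb]; rfl
        simp only [h1]
        have h2 := β.linearCombination_repr (Ideal.Quotient.mk q y)
        rw [Finsupp.linearCombination_apply, Finsupp.sum] at h2
        rw [h2, sub_self]
      refine ⟨s.mapRange (fun t => t • x) (by simp), ?_⟩
      rw [Finsupp.sum_mapRange_index (by simp)]
      have h3 : x ⊗ₜ[k] y - s.sum (fun w t => Algebra.TensorProduct.includeLeftRingHom (t • x) *
          (Algebra.TensorProduct.includeRight (R := k) (A := A) (B := A)).toRingHom (b w)) =
          (x ⊗ₜ[k] (1 : A)) * (Algebra.TensorProduct.includeRight (R := k) (A := A) (B := A)).toRingHom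
            (y - ∑ w ∈ s.support, s w • b w) := by
        simp [Finsupp.sum, TensorProduct.tmul_sub, TensorProduct.tmul_sum, TensorProduct.smul_tmul, mul_sub, Finset.mul_sum]
      rw [h3]
      exact Ideal.mul_mem_left _ _ (Submodule.mem_sup_right (Ideal.mem_map_of_mem _ hy))
  · let π := Algebra.TensorProduct.map (Ideal.Quotient.mkₐ k p) (Ideal.Quotient.mkₐ k q)
    have hk : p.map (Algebra.TensorProduct.includeLeftRingHom : A →+* A ⊗[k] A) +
        q.map ((Algebra.TensorProduct.includeRight (R := k) (A := A) (B := A)).toRingHom) ≤ RingHom.ker π := by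
      rw [Submodule.add_eq_sup, sup_le_iff, Ideal.map_le_iff_le_comap, Ideal.map_le_iff_le_comap]
      constructor
      · intro x hx
        have : Ideal.Quotient.mk p x = 0 := Ideal.Quotient.eq_zero_iff_mem.2 hx
        simp [π, RingHom.mem_ker, this]
      · intro x hx
        have : Ideal.Quotient.mk q x = 0 := Ideal.Quotient.eq_zero_iff_mem.2 hx
        simp [π, RingHom.mem_ker, this]
    have h0 : π _ = 0 := hk hv
    have h1 : ∑ w ∈ v.support, (Ideal.Quotient.mk p (v w)) • (β.baseChange (A ⧸ p)) w = 0 := by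
      rw [← h0, Finsupp.sum, map_sum]
      refine Finset.sum_congr rfl fun w _ => ?_
      simp [π, hb, TensorProduct.smul_tmul']
    have h2 := linearIndependent_iff'.1 (β.baseChange (A ⧸ p)).linearIndependent v.support _ h1
    by_cases hw : w ∈ v.support
    · exact Ideal.Quotient.eq_zero_iff_mem.1 (h2 w hw)
    · rw [Finsupp.notMem_support_iff.1 hw]
      exact p.zero_mem

lemma tp_right : TP ((Algebra.TensorProduct.includeRight (R := k) (A := A) (B := A)).toRingHom)
    (Algebra.TensorProduct.includeLeftRingHom : A →+* A ⊗[k] A) := by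
  have := (tp_left k A).map (Algebra.TensorProduct.comm k A A).toRingEquiv
  convert this using 1
  · ext x
    simp
  · ext x
    simp
end TPSec
end HCC
end

noncomputable section
namespace HCC
section FlatFilt
variable {A : Type} [CommRing A]

lemma exists_ker_matrix [IsNoetherianRing A] {r m : ℕ} (S : Fin m → Fin r → A) :
    ∃ (s : ℕ) (T : Fin r → Fin s → A), (∀ i t, ∑ j, S i j * T j t = 0) ∧
      ∀ v : Fin r → A, (∀ i, ∑ j, S i j * v j = 0) → ∃ u : Fin s → A, ∀ j, v j = ∑ t, T j t * u t := by
  obtain ⟨s, g, hg⟩ := Submodule.fg_iff_exists_fin_generating_family.1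
    (IsNoetherian.noetherian (LinearMap.ker (Matrix.mulVecLin (Matrix.of S))))
  refine ⟨s, fun j t => g t j, fun i t => ?_, fun v hv => ?_⟩
  · have : g t ∈ LinearMap.ker (Matrix.mulVecLin (Matrix.of S)) := by
      rw [← hg]
      exact Submodule.subset_span ⟨t, rfl⟩
    exact congrFun this i
  · have : v ∈ LinearMap.ker (Matrix.mulVecLin (Matrix.of S)) := funext hv
    rw [← hg, Submodule.mem_span_range_iff_exists_fun] at this
    obtain ⟨u, rfl⟩ := this
    refine ⟨u, fun j => ?_⟩
    simp [Finset.sum_apply, mul_comm]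

lemma mem_smul_top_pi {m : ℕ} (J : Ideal A) (w : Fin m → A) :
    w ∈ (J • ⊤ : Submodule A (Fin m → A)) ↔ ∀ i, w i ∈ J := by
  constructor
  · intro h i
    have := Submodule.mem_map_of_mem (f := LinearMap.proj i) h
    rw [Submodule.map_smul''] at this
    exact (Submodule.smul_mono le_rfl le_top : J • _ ≤ J • (⊤ : Ideal A)).trans (by simp) this
  · intro h
    have : w = ∑ i, w i • (Pi.single i 1 : Fin m → A) := by
      ext j
      simp [Finset.sum_apply, Pi.single_apply]
    rw [this]
    exact Submodule.sum_mem _ fun i _ => Submodule.smul_mem_smul (h i) trivial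

lemma artin_rees_matrix [IsNoetherianRing A] (a : Ideal A) {r m s : ℕ} (S : Fin m → Fin r → A)
    (T : Fin r → Fin s → A)
    (hST : ∀ v : Fin r → A, (∀ i, ∑ j, S i j * v j = 0) → ∃ u : Fin s → A, ∀ j, v j = ∑ t, T j t * u t) :
    ∃ c : ℕ, ∀ (n : ℕ) (v : Fin r → A), (∀ i, ∑ j, S i j * v j ∈ a ^ (n + c)) →
      ∃ u : Fin s → A, ∀ j, v j - ∑ t, T j t * u t ∈ a ^ n := by
  let L := Matrix.mulVecLin (Matrix.of S)
  obtain ⟨c, hc⟩ := Ideal.exists_pow_inf_eq_pow_smul a (LinearMap.range L)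
  refine ⟨c, fun n v hv => ?_⟩
  have h1 : L v ∈ (a ^ (n + c) • ⊤ ⊓ LinearMap.range L : Submodule A (Fin m → A)) :=
    ⟨(mem_smul_top_pi _ _).2 hv, ⟨v, rfl⟩⟩
  rw [hc _ (by omega), Nat.add_sub_cancel] at h1
  have h2 : L v ∈ (a ^ n • LinearMap.range L : Submodule A (Fin m → A)) :=
    Submodule.smul_mono le_rfl inf_le_right h1
  rw [← Submodule.map_top, ← Submodule.map_smul''] at h2
  obtain ⟨v', hv', e⟩ := h2
  obtain ⟨u, hu⟩ := hST (v - v') (fun i => by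
    have : L (v - v') = 0 := by rw [map_sub, e, sub_self]
    exact congrFun this i)
  refine ⟨u, fun j => ?_⟩
  rw [← hu]
  simpa using (mem_smul_top_pi _ _).1 hv' j

/-- a complete filtration with good bases modulo each step -/
structure Filt (a : Ideal A) {X : Type} [AddCommGroup X] [Module A X] (F : ℕ → Submodule A X) : Prop where
  anti : Antitone F
  sep : ∀ x, (∀ n, x ∈ F n) → x = 0
  comp : ∀ f : ℕ → X, (∀ n, f n ∈ F n) → ∃ z, ∀ n, z - ∑ i ∈ Finset.range n, f i ∈ F n
  pow : ∀ n, ∀ c ∈ a ^ n, ∀ x : X, c • x ∈ F n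
  base : ∀ n, ∃ (W : Type) (e : W → X), (∀ x, ∃ v : W →₀ A, x - Finsupp.linearCombination A e v ∈ F n) ∧
    (∀ v : W →₀ A, Finsupp.linearCombination A e v ∈ F n → ∀ w, v w ∈ a ^ n)

variable [IsNoetherianRing A] {a : Ideal A} {X : Type} [AddCommGroup X] [Module A X] {F : ℕ → Submodule A X}

lemma Filt.star (hF : Filt a F) {r m s : ℕ} (S : Fin m → Fin r → A)
    (T : Fin r → Fin s → A)
    (hST : ∀ v : Fin r → A, (∀ i, ∑ j, S i j * v j = 0) → ∃ u : Fin s → A, ∀ j, v j = ∑ t, T j t * u t) :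
    ∃ c : ℕ, ∀ (n : ℕ) (y : Fin r → X), (∀ i, ∑ j, S i j • y j ∈ F (n + c)) →
      ∃ z : Fin s → X, ∀ j, y j - ∑ t, T j t • z t ∈ F n := by
  classical
  obtain ⟨c, hc⟩ := artin_rees_matrix a S T hST
  refine ⟨c, fun n y hy => ?_⟩
  obtain ⟨W, e, he1, he2⟩ := hF.base (n + c)
  choose v hv using fun j => he1 (y j)
  have h1 : ∀ i w, ∑ j, S i j * v j w ∈ a ^ (n + c) := by
    intro i w
    have := he2 (∑ j, S i j • v j) (by
      rw [map_sum]
      have h : ∑ j, Finsupp.linearCombination A e (S i j • v j) = ∑ j, S i j • y j -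
          ∑ j, S i j • (y j - Finsupp.linearCombination A e (v j)) := by
        rw [← Finset.sum_sub_distrib]
        refine Finset.sum_congr rfl fun j _ => ?_
        rw [map_smul, smul_sub, sub_sub_cancel]
      rw [h]
      exact Submodule.sub_mem _ (hy i) (Submodule.sum_mem _ fun j _ => Submodule.smul_mem _ _ (hv j))) w
    simpa [Finsupp.finsetSum_apply] using this
  choose u hu using fun w => hc n (fun j => v j w) (fun i => h1 i w)
  let W0 : Finset W := Finset.univ.biUnion fun j => (v j).support
  refine ⟨fun t => ∑ w ∈ W0, u w t • e w, fun j => ?_⟩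
  have h2 : Finsupp.linearCombination A e (v j) = ∑ w ∈ W0, v j w • e w := by
    rw [Finsupp.linearCombination_apply]
    exact Finsupp.sum_of_support_subset _ (Finset.subset_biUnion_of_mem (fun j => (v j).support) (Finset.mem_univ j))
      _ (by simp)
  have h3 : y j - ∑ t, T j t • ∑ w ∈ W0, u w t • e w =
      (y j - Finsupp.linearCombination A e (v j)) + ∑ w ∈ W0, (v j w - ∑ t, T j t * u w t) • e w := by
    rw [h2]
    simp only [sub_smul, Finset.sum_sub_distrib, Finset.sum_smul, Finset.smul_sum, mul_smul]
    rw [Finset.sum_comm]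
    abel
  rw [h3]
  exact Submodule.add_mem _ (hF.anti (Nat.le_add_right n c) (hv j))
    (Submodule.sum_mem _ fun w _ => hF.pow n _ (hu w j) _)

lemma Filt.closed (hF : Filt a F) {r m : ℕ} (S : Fin m → Fin r → A) (x : Fin m → X)
    (hx : ∀ n, ∃ y : Fin r → X, ∀ i, x i - ∑ j, S i j • y j ∈ F n) :
    ∃ y : Fin r → X, ∀ i, x i = ∑ j, S i j • y j := by
  obtain ⟨s, T, hT1, hT2⟩ := exists_ker_matrix S
  obtain ⟨c, hc⟩ := hF.star S T hT2
  have step : ∀ n (Y : {Y : Fin r → X // ∀ i, x i - ∑ j, S i j • Y j ∈ F (n + c)}),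
      ∃ Y' : {Y : Fin r → X // ∀ i, x i - ∑ j, S i j • Y j ∈ F (n + 1 + c)}, ∀ j, Y'.1 j - Y.1 j ∈ F n := by
    rintro n ⟨Y, hY⟩
    obtain ⟨y, hy⟩ := hx (n + 1 + c)
    obtain ⟨z, hz⟩ := hc n (fun j => y j - Y j) (fun i => by
      have : ∑ j, S i j • (y j - Y j) = (x i - ∑ j, S i j • Y j) - (x i - ∑ j, S i j • y j) := by
        simp only [smul_sub, Finset.sum_sub_distrib]
        abel
      rw [this]
      exact Submodule.sub_mem _ (hY i) (hF.anti (by omega) (hy i)))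
    refine ⟨⟨fun j => y j - ∑ t, T j t • z t, fun i => ?_⟩, fun j => ?_⟩
    · have : ∑ j, S i j • (y j - ∑ t, T j t • z t) = ∑ j, S i j • y j := by
        simp only [smul_sub, Finset.sum_sub_distrib, Finset.smul_sum, ← mul_smul]
        rw [Finset.sum_comm]
        simp only [← Finset.sum_smul, hT1]
        simp
      rw [this]
      exact hy i
    · have := hz j
      simp only at this ⊢
      convert this using 1
      abel
  choose nx hnx using step
  obtain ⟨y0, hy0⟩ := hx c
  let Y : ∀ n, {Y : Fin r → X // ∀ i, x i - ∑ j, S i j • Y j ∈ F (n + c)} := fun n =>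
    Nat.rec ⟨y0, by simpa using hy0⟩ (fun n Y => nx n Y) n
  have hY : ∀ n j, (Y (n+1)).1 j - (Y n).1 j ∈ F n := fun n j => hnx n (Y n) j
  choose z hz using fun j => hF.comp (fun n => (Y (n+1)).1 j - (Y n).1 j) (fun n => hY n j)
  refine ⟨fun j => z j + (Y 0).1 j, fun i => ?_⟩
  rw [← sub_eq_zero]
  refine hF.sep _ fun n => ?_
  have h1 : ∀ j, z j + (Y 0).1 j - (Y n).1 j ∈ F n := fun j => by
    have := hz j n
    rw [Finset.sum_range_sub (fun n => (Y n).1 j)] at this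
    convert this using 1
    abel
  have h2 : x i - ∑ j, S i j • (z j + (Y 0).1 j) = (x i - ∑ j, S i j • (Y n).1 j) -
      ∑ j, S i j • (z j + (Y 0).1 j - (Y n).1 j) := by
    simp only [smul_sub, Finset.sum_sub_distrib]
    abel
  rw [h2]
  exact Submodule.sub_mem _ (hF.anti (Nat.le_add_right n c) ((Y n).2 i))
    (Submodule.sum_mem _ fun j _ => Submodule.smul_mem _ _ (h1 j))

lemma Filt.flat (hF : Filt a F) : Module.Flat A X := by
  refine Module.Flat.of_forall_isTrivialRelation ?_
  intro r c x hx
  let S : Fin 1 → Fin r → A := fun _ => c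
  obtain ⟨s, T, hT1, hT2⟩ := exists_ker_matrix S
  obtain ⟨k, hk⟩ := hF.star S T hT2
  obtain ⟨z, hz⟩ := hF.closed T x (fun n => hk n x (fun i => by
    show ∑ j, c j • x j ∈ _
    rw [hx]
    exact Submodule.zero_mem _))
  exact ⟨s, T, z, hz, fun t => hT1 0 t⟩
end FlatFilt
end HCC
end

noncomputable section
namespace HCC
section FiltViaSec
variable {A C : Type} [CommRing A] [CommRing C]

/-- complete filtrations, with scalars acting through a ring map -/
structure FiltVia (f : A →+* C) (a : Ideal A) {X : Type} [AddCommGroup X] [Module C X] (F : ℕ → Submodule C X) : Prop where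
  anti : Antitone F
  sep : ∀ x, (∀ n, x ∈ F n) → x = 0
  comp : ∀ f : ℕ → X, (∀ n, f n ∈ F n) → ∃ z, ∀ n, z - ∑ i ∈ Finset.range n, f i ∈ F n
  pow : ∀ n, ∀ c ∈ a ^ n, ∀ x : X, f c • x ∈ F n
  base : ∀ n, ∃ (W : Type) (e : W → X), (∀ x, ∃ v : W →₀ A, x - v.sum (fun w t => f t • e w) ∈ F n) ∧
    (∀ v : W →₀ A, v.sum (fun w t => f t • e w) ∈ F n → ∀ w, v w ∈ a ^ n)

variable {f : A →+* C} {a : Ideal A} {X : Type} [AddCommGroup X] [Module C X] {F : ℕ → Submodule C X}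

lemma FiltVia.filt (hF : FiltVia f a F) :
    let _ : Module A X := Module.compHom X f
    ∃ F' : ℕ → Submodule A X, (∀ n x, x ∈ F' n ↔ x ∈ F n) ∧ Filt a F' := by
  intro inst
  refine ⟨fun n => { (F n).toAddSubmonoid with smul_mem' := fun c x h => (F n).smul_mem (f c) h },
    fun n x => Iff.rfl, ?_⟩
  exact ⟨fun m n h x hx => hF.anti h hx, hF.sep, hF.comp, hF.pow, hF.base⟩

lemma FiltVia.flat [IsNoetherianRing A] (hF : FiltVia f a F) : FlatVia f X := by
  let _ : Module A X := Module.compHom X f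
  obtain ⟨F', _, h⟩ := hF.filt
  exact h.flat

lemma FiltVia.closed [IsNoetherianRing A] (hF : FiltVia f a F) {r : ℕ} (S : Fin r → A) (x : X)
    (hx : ∀ n, ∃ y : Fin r → X, x - ∑ j, f (S j) • y j ∈ F n) :
    ∃ y : Fin r → X, x = ∑ j, f (S j) • y j := by
  let _ : Module A X := Module.compHom X f
  obtain ⟨F', h', h⟩ := hF.filt
  obtain ⟨y, hy⟩ := h.closed (m := 1) (fun _ => S) (fun _ => x) (fun n => by
    obtain ⟨y, hy⟩ := hx n
    exact ⟨y, fun _ => (h' _ _).2 hy⟩)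
  exact ⟨y, hy 0⟩

lemma flatVia_of_basis {W : Type} (e : W → X) (h1 : ∀ x, ∃ v : W →₀ A, x = v.sum (fun w t => f t • e w))
    (h2 : ∀ v : W →₀ A, v.sum (fun w t => f t • e w) = 0 → ∀ w, v w = 0) : FlatVia f X := by
  let _ : Module A X := Module.compHom X f
  have hb : Function.Bijective (Finsupp.linearCombination A e) := by
    constructor
    · rw [injective_iff_map_eq_zero]
      intro v hv
      ext w
      exact h2 v hv w
    · intro x
      obtain ⟨v, hv⟩ := h1 x
      exact ⟨v, hv.symm⟩
  exact Module.Flat.of_linearEquiv (LinearEquiv.ofBijective _ hb).symm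

variable {l r : A →+* C}

lemma good_self (h : TP l r) (h' : TP r l) (a : Ideal A) : Good l r a C := by
  refine ⟨?_, ?_, ?_⟩
  · obtain ⟨W, b, h1, h2⟩ := h ⊥ ⊥
    simp only [Ideal.map_bot, Submodule.add_eq_sup, bot_sup_eq, Ideal.mem_bot, sub_eq_zero] at h1 h2
    exact flatVia_of_basis (fun w => r (b w)) h1 h2
  · obtain ⟨W, b, h1, h2⟩ := h' ⊥ a
    have hs : ∀ v : W →₀ A, v.sum (fun w t => r t • (Submodule.Quotient.mk (l (b w)) : C ⧸ (a.map l • ⊤ : Submodule C C))) =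
       Submodule.Quotient.mk (v.sum (fun w x => r x * l (b w))) := by
      intro v
      rw [← Submodule.mkQ_apply, Finsupp.sum, Finsupp.sum, map_sum]
      rfl
    have ht : (a.map l • ⊤ : Submodule C C) = (⊥ : Ideal A).map r + a.map l := by
      rw [Ideal.map_bot, Submodule.add_eq_sup, bot_sup_eq, smul_eq_mul, Ideal.mul_top]
    refine flatVia_of_basis (fun w => Submodule.Quotient.mk (l (b w))) (fun x => ?_) (fun v hv w => ?_)
    · obtain ⟨x, rfl⟩ := Submodule.Quotient.mk_surjective _ x
      obtain ⟨v, hv⟩ := h1 x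
      refine ⟨v, ?_⟩
      rw [hs, Submodule.Quotient.eq, ht]
      exact hv
    · rw [hs, Submodule.Quotient.mk_eq_zero, ht] at hv
      exact h2 v hv w
  · intro N N' _ _ _ _ g hg hN h
    obtain ⟨n, hn⟩ := hg (h 1)
    refine ⟨LinearMap.toSpanSingleton C N n, fun x => ?_⟩
    rw [LinearMap.toSpanSingleton_apply, map_smul, hn, ← map_smul, smul_eq_mul, mul_one]

end FiltViaSec

section Completion
variable {A C : Type} [CommRing A] [CommRing C] (l r : A →+* C) (a : Ideal A)
variable {H : Type} [AddCommGroup H] [Module C H] (u : H)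

/-- `(H,u)` is an adic completion of `C` as a module -/
structure IsCompl (I : Ideal C) (u : H) : Prop where
  D1 : ∀ n (x : H), ∃ c : C, x - c • u ∈ (I ^ n • ⊤ : Submodule C H)
  D2 : ∀ n (c : C), c • u ∈ (I ^ n • ⊤ : Submodule C H) → c ∈ I ^ n
  complete : IsAdicComplete I H

variable {u}
lemma IsCompl.D3 {I : Ideal C} (h : IsCompl I u) (K : Ideal C) (N : ℕ) (hK : I ^ N ≤ K) (c : C)
    (hc : c • u ∈ (K • ⊤ : Submodule C H)) : c ∈ K := by
  have key : ∀ y ∈ (K • ⊤ : Submodule C H), ∃ k ∈ K, y - k • u ∈ (I ^ N • ⊤ : Submodule C H) := by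
    intro y hy
    refine Submodule.smul_induction_on hy ?_ ?_
    · intro k hk x _
      obtain ⟨c, hc⟩ := h.D1 N x
      refine ⟨k * c, K.mul_mem_right _ hk, ?_⟩
      rw [mul_smul, ← smul_sub]
      exact Submodule.smul_mem _ _ hc
    · rintro x y ⟨k, hk, e⟩ ⟨k', hk', e'⟩
      refine ⟨k + k', K.add_mem hk hk', ?_⟩
      rw [add_smul, add_sub_add_comm]
      exact Submodule.add_mem _ e e'
  obtain ⟨k, hk, e⟩ := key _ hc
  rw [← sub_smul] at e
  have := hK (h.D2 N _ e)
  have h3 := K.add_mem this hk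
  rwa [sub_add_cancel] at h3

lemma pow_le_K (n : ℕ) : (a.map l + a.map r) ^ (2 * n) ≤ (a ^ n).map l + (a ^ n).map r := by
  rw [Ideal.map_pow, Ideal.map_pow, two_mul]
  have := Ideal.sup_pow_add_le_pow_sup_pow (I := a.map l) (J := a.map r) (n := n) (m := n)
  exact this

lemma K_le_pow (n : ℕ) : (a ^ n).map l + (a ^ n).map r ≤ (a.map l + a.map r) ^ n := by
  rw [Ideal.map_pow, Ideal.map_pow]
  exact sup_le (Ideal.pow_right_mono le_sup_left n) (Ideal.pow_right_mono le_sup_right n)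

lemma add_pow_le_add_pow (L R : Ideal C) (n : ℕ) : (L + R) ^ n ≤ L + R ^ n := by
  simp only [Submodule.add_eq_sup]
  induction n with
  | zero => simp
  | succ n ih =>
    rw [pow_succ]
    refine le_trans (Ideal.mul_mono ih le_rfl) ?_
    rw [Ideal.mul_le]
    intro x hx y hy
    obtain ⟨x1, h1, x2, h2, rfl⟩ := Submodule.mem_sup.1 hx
    obtain ⟨y1, k1, y2, k2, rfl⟩ := Submodule.mem_sup.1 hy
    have e : (x1 + x2) * (y1 + y2) = (x1 * (y1 + y2) + x2 * y1) + x2 * y2 := by ring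
    rw [e]
    refine Submodule.add_mem_sup (L.add_mem (L.mul_mem_right _ h1) (L.mul_mem_left _ k1)) ?_
    rw [pow_succ]
    exact Ideal.mul_mem_mul h2 k2

lemma pow_le_G (n : ℕ) : (a.map l + a.map r) ^ n ≤ a.map l + (a ^ n).map r := by
  rw [Ideal.map_pow]
  exact add_pow_le_add_pow _ _ n

lemma K_le_G (n : ℕ) : (a ^ n).map l + (a ^ n).map r ≤ a.map l + (a ^ n).map r := by
  obtain _ | n := n
  · simp [Ideal.map_top]
  · exact sup_le_sup_right (Ideal.map_mono (Ideal.pow_le_self (by omega))) _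

variable {l r a}

lemma IsCompl.filt1 (h : TP l r) (hH : IsCompl (a.map l + a.map r) u) :
    FiltVia l a (fun n => (((a ^ n).map l + (a ^ n).map r) • ⊤ : Submodule C H)) := by
  have := hH.complete
  set I := a.map l + a.map r with hI
  have hanti : Antitone (fun n => (((a ^ n).map l + (a ^ n).map r) • ⊤ : Submodule C H)) := by
    intro m n hmn
    refine Submodule.smul_mono ?_ le_rfl
    exact sup_le_sup (Ideal.map_mono (Ideal.pow_le_pow_right hmn)) (Ideal.map_mono (Ideal.pow_le_pow_right hmn))
  have hle : ∀ n, (((a ^ n).map l + (a ^ n).map r) • ⊤ : Submodule C H) ≤ I ^ n • ⊤ := fun n =>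
    Submodule.smul_mono (K_le_pow l r a n) le_rfl
  have hge : ∀ n, (I ^ (2 * n) • ⊤ : Submodule C H) ≤ ((a ^ n).map l + (a ^ n).map r) • ⊤ := fun n =>
    Submodule.smul_mono (pow_le_K l r a n) le_rfl
  refine ⟨hanti, ?_, ?_, ?_, ?_⟩
  · intro x hx
    refine IsHausdorff.haus (inferInstance : IsHausdorff I H) _ fun n => ?_
    rw [SModEq.zero]
    exact hle n (hx n)
  · intro f hf
    have hsub : ∀ (m n : ℕ), m ≤ n → ∑ i ∈ Finset.range n, f i - ∑ i ∈ Finset.range m, f i ∈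
        (((a ^ m).map l + (a ^ m).map r) • ⊤ : Submodule C H) := by
      intro m n hmn
      rw [Finset.sum_range_sub_sum_range hmn]
      refine Submodule.sum_mem _ fun i hi => hanti ?_ (hf i)
      simpa using (Finset.mem_filter.1 hi).2
    obtain ⟨z, hz⟩ := IsPrecomplete.prec (inferInstance : IsPrecomplete I H)
      (f := fun n => ∑ i ∈ Finset.range n, f i) (fun {m n} hmn => by
        rw [SModEq.comm, SModEq.sub_mem]
        exact hle m (hsub m n hmn))
    refine ⟨z, fun n => ?_⟩
    have h1 := hz (2 * n)
    rw [SModEq.comm, SModEq.sub_mem] at h1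
    rw [← sub_add_sub_cancel _ (∑ i ∈ Finset.range (2 * n), f i)]
    exact Submodule.add_mem _ (hge n h1) (hsub _ _ (by omega))
  · intro n c hc x
    exact Submodule.smul_mem_smul (Submodule.mem_sup_left (Ideal.mem_map_of_mem _ hc)) trivial
  · intro n
    obtain ⟨W, b, h1, h2⟩ := h (a ^ n) (a ^ n)
    have hs : ∀ v : W →₀ A, v.sum (fun w t => l t • r (b w) • u) = (v.sum (fun w x => l x * r (b w))) • u := by
      intro v
      simp [Finsupp.sum, Finset.sum_smul, mul_smul]
    refine ⟨W, fun w => r (b w) • u, fun x => ?_, fun v hv => ?_⟩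
    · obtain ⟨c, hc⟩ := hH.D1 (2 * n) x
      obtain ⟨v, hv⟩ := h1 c
      refine ⟨v, ?_⟩
      rw [hs, ← sub_add_sub_cancel _ (c • u), ← sub_smul]
      exact Submodule.add_mem _ (hge n hc) (Submodule.smul_mem_smul hv trivial)
    · rw [hs] at hv
      exact h2 v (hH.D3 _ _ (pow_le_K l r a n) _ hv)

lemma IsCompl.filt2 [IsNoetherianRing A] (h : TP l r) (h' : TP r l) (hH : IsCompl (a.map l + a.map r) u) :
    FiltVia r a (fun n => ((a ^ n).map r • ⊤ : Submodule C (H ⧸ (a.map l • ⊤ : Submodule C H)))) := by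
  have hF := hH.filt1 h
  have hge : ∀ n, ((a.map l + a.map r) ^ n • ⊤ : Submodule C H) ≤ (a.map l + (a ^ n).map r) • ⊤ := fun n =>
    Submodule.smul_mono (pow_le_G l r a n) le_rfl
  refine ⟨?_, ?_, ?_, ?_, ?_⟩
  · intro m n hmn
    exact Submodule.smul_mono (Ideal.map_mono (Ideal.pow_le_pow_right hmn)) le_rfl
  · intro x hx
    obtain ⟨x, rfl⟩ := Submodule.Quotient.mk_surjective _ x
    obtain ⟨s, g, hg⟩ := Submodule.fg_iff_exists_fin_generating_family.1 (IsNoetherian.noetherian a)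
    have hga : ∀ j, g j ∈ a := fun j => by
      rw [← hg]
      exact Submodule.subset_span ⟨j, rfl⟩
    obtain ⟨y, hy⟩ := hF.closed g x (fun n => by
      have h1 := hx n
      rw [← mem_two_step, Submodule.add_eq_sup, Submodule.sup_smul] at h1
      obtain ⟨y, hy, z, hz, rfl⟩ := Submodule.mem_sup.1 h1
      have key : ∀ y ∈ (a.map l • ⊤ : Submodule C H), ∃ w : Fin s → H, y = ∑ j, l (g j) • w j := by
        intro y hy
        obtain ⟨m, c, w, hc, rfl⟩ := (mem_map_smul_top l a y).1 hy
        have : ∀ t, ∃ d : Fin s → A, ∑ j, d j • g j = c t := fun t => by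
          have := hc t
          rw [← hg] at this
          exact Submodule.mem_span_range_iff_exists_fun A |>.1 this
        choose d hd using this
        refine ⟨fun j => ∑ t, l (d t j) • w t, ?_⟩
        simp only [← hd, map_sum, Finset.sum_smul, Finset.smul_sum, ← mul_smul, smul_eq_mul, map_mul]
        rw [Finset.sum_comm]
        simp only [mul_comm]
      obtain ⟨w, rfl⟩ := key y hy
      refine ⟨w, ?_⟩
      rw [add_sub_cancel_left]
      exact Submodule.smul_mono le_sup_right le_rfl hz)
    rw [Submodule.Quotient.mk_eq_zero, hy]
    exact Submodule.sum_mem _ fun j _ => Submodule.smul_mem_smul (Ideal.mem_map_of_mem _ (hga j)) trivial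
  · intro f hf
    have : ∀ n, ∃ x ∈ ((a ^ n).map r • ⊤ : Submodule C H), Submodule.Quotient.mk x = f n := fun n => by
      have h1 := hf n
      have h2 : ((a ^ n).map r • ⊤ : Submodule C (H ⧸ (a.map l • ⊤ : Submodule C H))) =
        Submodule.map (Submodule.mkQ (a.map l • ⊤ : Submodule C H)) ((a ^ n).map r • ⊤) := by
          rw [Submodule.map_smul'', Submodule.map_top, Submodule.range_mkQ]
      simp only [h2] at h1
      exact h1
    choose x hx hxf using this
    obtain ⟨z, hz⟩ := hF.comp x (fun n => Submodule.smul_mono le_sup_right le_rfl (hx n))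
    refine ⟨Submodule.Quotient.mk z, fun n => ?_⟩
    have h1 := Submodule.smul_mono (K_le_G l r a n) le_rfl (hz n)
    rw [mem_two_step] at h1
    convert h1 using 1
    rw [Submodule.Quotient.mk_sub, ← Submodule.mkQ_apply _ (∑ i ∈ Finset.range n, x i), map_sum]
    simp only [Submodule.mkQ_apply, hxf]
  · intro n c hc x
    exact Submodule.smul_mem_smul (Ideal.mem_map_of_mem _ hc) trivial
  · intro n
    obtain ⟨W, b, h1, h2⟩ := h' (a ^ n) a
    have hs : ∀ v : W →₀ A, v.sum (fun w t => r t • (Submodule.Quotient.mk (l (b w) • u) : H ⧸ (a.map l • ⊤ : Submodule C H))) =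
        Submodule.Quotient.mk ((v.sum (fun w x => r x * l (b w))) • u) := by
      intro v
      rw [← Submodule.mkQ_apply, Finsupp.sum, Finsupp.sum, Finset.sum_smul, map_sum]
      simp only [mul_smul]
      rfl
    refine ⟨W, fun w => Submodule.Quotient.mk (l (b w) • u), fun x => ?_, fun v hv => ?_⟩
    · obtain ⟨x, rfl⟩ := Submodule.Quotient.mk_surjective _ x
      obtain ⟨c, hc⟩ := hH.D1 n x
      obtain ⟨v, hv⟩ := h1 c
      refine ⟨v, ?_⟩
      rw [hs, ← Submodule.Quotient.mk_sub, ← mem_two_step, ← sub_add_sub_cancel _ (c • u), ← sub_smul]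
      rw [add_comm] at hv
      exact Submodule.add_mem _ (hge n hc) (Submodule.smul_mem_smul hv trivial)
    · rw [hs, ← mem_two_step] at hv
      have := hH.D3 _ _ (pow_le_G l r a n) _ hv
      rw [add_comm] at this
      exact h2 v this

lemma IsCompl.good [IsNoetherianRing A] (h : TP l r) (h' : TP r l) (hH : IsCompl (a.map l + a.map r) u) :
    Good l r a H := by
  refine ⟨(hH.filt1 h).flat, (hH.filt2 h h').flat, ?_⟩
  intro N N' _ _ _ _ g hg hN f
  set I := a.map l + a.map r with hI
  obtain ⟨n, hn⟩ := hg (f u)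
  let q : C →ₗ[C] (H ⧸ (I • ⊤ : Submodule C H)) := Submodule.mkQ _ ∘ₗ LinearMap.toSpanSingleton C H u
  have hd : ∀ x, ∃ c : C, x - c • u ∈ (I • ⊤ : Submodule C H) := fun x => by
    simpa using hH.D1 1 x
  have hq : Function.Surjective q := by
    intro x
    obtain ⟨x, rfl⟩ := Submodule.Quotient.mk_surjective _ x
    obtain ⟨c, hc⟩ := hd x
    refine ⟨c, ?_⟩
    rw [eq_comm]
    exact (Submodule.Quotient.eq _).2 hc
  let e := q.quotKerEquivOfSurjective hq
  let t : (C ⧸ LinearMap.ker q) →ₗ[C] N := Submodule.liftQ _ (LinearMap.toSpanSingleton C N n) (by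
    intro c hc
    have hc' : c • u ∈ (I • ⊤ : Submodule C H) := (Submodule.Quotient.mk_eq_zero _).1 hc
    have := hH.D2 1 c (by simpa using hc')
    rw [pow_one] at this
    exact hN c this n)
  refine ⟨t ∘ₗ e.symm.toLinearMap ∘ₗ Submodule.mkQ _, fun x => ?_⟩
  obtain ⟨c, hc⟩ := hd x
  have h1 : e.symm (Submodule.Quotient.mk x) = Submodule.Quotient.mk c := by
    rw [LinearEquiv.symm_apply_eq]
    exact (Submodule.Quotient.eq _).2 hc
  have h2 : (t ∘ₗ e.symm.toLinearMap ∘ₗ Submodule.mkQ _) x = c • n := by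
    show t (e.symm (Submodule.Quotient.mk x)) = _
    rw [h1]
    rfl
  have h3 : f (x - c • u) = 0 := by
    have : (I • ⊤ : Submodule C H) ≤ LinearMap.ker f := by
      rw [Submodule.smul_le]
      intro c hc y _
      obtain ⟨m, hm⟩ := hg (f y)
      rw [LinearMap.mem_ker, map_smul, ← hm, ← map_smul, hN c hc, map_zero]
    exact this hc
  rw [h2, map_smul, hn]
  rw [map_sub, map_smul, sub_eq_zero] at h3
  exact h3.symm
end Completion
end HCC
end

noncomputable section
open CategoryTheory Limits
namespace HCC
section Final
open scoped TensorProduct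

lemma complete_of_finite {A : Type} [CommRing A] [IsNoetherianRing A] (a : Ideal A) [IsAdicComplete a A]
    (M : Type) [AddCommGroup M] [Module A M] [Module.Finite A M] : IsAdicComplete a M := by
  have h1 : IsHausdorff a M := IsHausdorff.of_le_jacobson a M (IsAdicComplete.le_jacobson_bot a)
  have h2 : IsPrecomplete a M := by
    rw [← AdicCompletion.of_surjective_iff]
    intro y
    obtain ⟨t, rfl⟩ := AdicCompletion.ofTensorProduct_surjective_of_finite a M y
    induction t using TensorProduct.induction_on with
    | zero => exact ⟨0, by simp⟩
    | add x y hx hy =>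
      obtain ⟨u, hu⟩ := hx
      obtain ⟨v, hv⟩ := hy
      exact ⟨u + v, by rw [map_add, map_add, hu, hv]⟩
    | tmul r x =>
      obtain ⟨s, rfl⟩ := AdicCompletion.of_surjective a A r
      refine ⟨s • x, ?_⟩
      rw [AdicCompletion.ofTensorProduct_tmul, map_smul]
      ext n
      rfl
  exact { h1, h2 with }

def isoOf {A C H : Type} [CommRing A] [CommRing C] [CommRing H] (φ : C →+* H) (ψ : H →+* A)
    (θ : C →+* A) (hs : ∀ c, ψ (φ c) = θ c) (M : Type) [AddCommGroup M] [Module A M] :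
    letI : Module H M := Module.compHom M ψ
    letI : Module C M := Module.compHom M θ
    (ModuleCat.restrictScalars φ).obj (ModuleCat.of H M) ≅ ModuleCat.of C M :=
  letI : Module H M := Module.compHom M ψ
  letI : Module C M := Module.compHom M θ
  @LinearEquiv.toModuleIso C _ M M _ _ (Module.compHom M (ψ.comp φ)) (Module.compHom M θ)
    (letI : Module C M := Module.compHom M θ
     @LinearEquiv.mk C C _ _ _ _ _ _ M M _ _ (Module.compHom M (ψ.comp φ)) _
      (@LinearMap.mk C C _ _ _ M M _ _ (Module.compHom M (ψ.comp φ)) _ (AddHom.id M)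
        (fun c (x : M) => by
          change ψ (φ c) • x = θ c • x
          rw [hs])) id (fun _ => rfl) (fun _ => rfl))

lemma complete_compHom {A C : Type} [CommRing A] [CommRing C] (θ : C →+* A) (I : Ideal C)
    (M : Type) [AddCommGroup M] [Module A M] (h : IsAdicComplete (I.map θ) M) :
    letI : Module C M := Module.compHom M θ
    IsAdicComplete I M := by
  letI : Module C M := Module.compHom M θ
  letI : Algebra C A := θ.toAlgebra
  haveI : IsScalarTower C A M := ⟨fun c x m => by
    change (θ c * x) • m = θ c • x • m
    rw [mul_smul]⟩
  exact (IsAdicComplete.map_algebraMap_iff (R := C) (S := A) (I := I) (M := M)).1 h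

lemma isCompl_one {C H : Type} [CommRing C] [CommRing H] (φ : C →+* H) (I : Ideal C)
    (hc : IsAdicComplete (I.map φ) H)
    (D1 : ∀ n (x : H), ∃ c : C, x - φ c ∈ (I.map φ) ^ n)
    (D2 : ∀ n (c : C), φ c ∈ (I.map φ) ^ n → c ∈ I ^ n) :
    letI : Module C H := Module.compHom H φ
    IsCompl I (1 : H) := by
  letI : Algebra C H := φ.toAlgebra
  have hm : ∀ n (x : H), x ∈ (I ^ n • ⊤ : Submodule C H) ↔ x ∈ (I.map φ) ^ n := by
    intro n x
    rw [Ideal.smul_top_eq_map, ← Ideal.map_pow]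
    rfl
  have key : IsCompl I (1 : H) := by
    refine ⟨fun n x => ?_, fun n c h => ?_, ?_⟩
    · obtain ⟨c, h⟩ := D1 n x
      refine ⟨c, (hm _ _).2 ?_⟩
      rw [Algebra.smul_def, mul_one]
      exact h
    · rw [hm, Algebra.smul_def, mul_one] at h
      exact D2 n c h
    · exact (IsAdicComplete.map_algebraMap_iff (R := C) (S := H) (I := I) (M := H)).1 hc
  exact key

variable {A C H : Type} [CommRing A] [CommRing C] [CommRing H] [IsNoetherianRing A]
  {l r : A →+* C}

lemma main_compare (h : TP l r) (h' : TP r l) (a : Ideal A) [IsAdicComplete a A]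
    (M : Type) [AddCommGroup M] [Module A M] [Module.Finite A M]
    (φ : C →+* H) (hc : IsAdicComplete ((a.map l + a.map r).map φ) H)
    (D1 : ∀ n (x : H), ∃ c : C, x - φ c ∈ ((a.map l + a.map r).map φ) ^ n)
    (D2 : ∀ n (c : C), φ c ∈ ((a.map l + a.map r).map φ) ^ n → c ∈ (a.map l + a.map r) ^ n)
    (ψ : H →+* A) (hl : (ψ.comp φ).comp l = RingHom.id A) (hr : (ψ.comp φ).comp r = RingHom.id A)
    (X : ModuleCat.{0} H) (X' Y' : ModuleCat.{0} C) :
    letI : Module H M := Module.compHom M ψ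
    ((ModuleCat.restrictScalars φ).obj X ≅ X') →
    ((ModuleCat.restrictScalars φ).obj (ModuleCat.of H M) ≅ Y') → ∀ n : ℕ,
    Nonempty ((((_root_.Ext C (ModuleCat C) n).obj (Opposite.op X')).obj Y') ≃+
      (((_root_.Ext H (ModuleCat H) n).obj (Opposite.op X)).obj (ModuleCat.of H M))) := by
  letI iM : Module H M := Module.compHom M ψ
  intro eX eY n
  set I := a.map l + a.map r with hI
  have hM : IsAdicComplete a M := complete_of_finite a M
  have hIa : I.map (ψ.comp φ) = a := by
    rw [hI, Submodule.add_eq_sup, Ideal.map_sup, Ideal.map_map, Ideal.map_map, hl, hr, Ideal.map_id, sup_idem]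
  have hIa' : (I.map φ).map ψ = a := by rw [Ideal.map_map, hIa]
  refine ext_compare φ X (ModuleCat.of H M) ?_ ?_ X' Y' eX eY n
  · intro Z f fadd fsmul c x
    let f' : Z →+ M := AddMonoidHom.mk' f fadd
    have f1 : ∀ n, ∀ d ∈ (I.map φ) ^ n, ∀ x : Z, f' (d • x) ∈ (a ^ n • ⊤ : Submodule A M) := by
      intro n d hd
      rw [← Ideal.map_pow] at hd
      refine Submodule.span_induction ?_ ?_ ?_ ?_ hd
      · rintro _ ⟨i, hi, rfl⟩ x
        have : f' (φ i • x) = ψ (φ i) • f' x := fsmul i x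
        rw [this]
        refine Submodule.smul_mem_smul ?_ trivial
        have := Ideal.mem_map_of_mem (ψ.comp φ) hi
        rwa [Ideal.map_pow, hIa] at this
      · intro x; simp
      · intro u v _ _ hu hv x
        rw [add_smul, map_add]
        exact add_mem (hu x) (hv x)
      · intro s u _ hu x
        rw [smul_eq_mul, mul_comm, mul_smul]
        exact hu _
    have f2 : ∀ n, ∀ d ∈ (I.map φ) ^ n, ψ d ∈ a ^ n := by
      intro n d hd
      have := Ideal.mem_map_of_mem ψ hd
      rwa [Ideal.map_pow, hIa'] at this
    change f' (c • x) = ψ c • f' x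
    rw [← sub_eq_zero]
    refine hM.toIsHausdorff.haus' _ fun n => ?_
    rw [SModEq.zero]
    obtain ⟨c', hc'⟩ := D1 n c
    have e1 : f' (c • x) - ψ c • f' x = f' ((c - φ c') • x) - ψ (c - φ c') • f' x := by
      have : f' (φ c' • x) = ψ (φ c') • f' x := fsmul c' x
      rw [sub_smul, map_sub, map_sub, sub_smul, this]
      abel
    rw [e1]
    exact sub_mem (f1 n _ hc' x) (Submodule.smul_mem_smul (f2 n _ hc') trivial)
  · intro W n
    letI iH : Module C H := Module.compHom H φ
    letI iCM : Module C M := Module.compHom M (ψ.comp φ)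
    have g1 : Good l r a H := IsCompl.good h h' (isCompl_one φ I hc D1 D2)
    have g0 : Good l r a C := good_self h h' a
    haveI : IsAdicComplete I M := complete_compHom (ψ.comp φ) I M (by rw [hIa]; exact hM)
    exact Good.ext_vanish g0 M n (W →₀ H) (g1.finsupp W)
end Final
end HCC
end

open Adhoc19 in
/-- Let `k` be a field and `A` a noetherian `k`-algebra which is `a`-adically
complete for some ideal `a ⊆ A`.  Then for every finitely generated `A`-module
`M` and every `n`, the ordinary Hochschild cohomology
`HH^n(A|k; M) = Ext^n_{A⊗ₖA}(A, M)` is isomorphic to the adic (topological)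
Hochschild cohomology `ĤH^n(A|k; M) = Ext^n_{Chat}(A, M)`, where
`φ : A ⊗ₖ A → Chat` is the completion of `A ⊗ₖ A` at the ideal
`a^e = a ⊗ A + A ⊗ a` and `ψ : Chat → A` is the induced map, through which `A`
and `M` are `Chat`-modules. -/
theorem hochschild_cohomology_comparison
    (k A : Type) [Field k] [CommRing A] [Algebra k A]
    [IsNoetherianRing A] (a : Ideal A) [IsAdicComplete a A]
    (M : Type) [AddCommGroup M] [Module A M] [Module.Finite A M]
    -- `Chat` together with `φ` is the `a^e`-adic completion of `A ⊗ₖ A`: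
    (Chat : Type) [CommRing Chat] (φ : (A ⊗[k] A) →+* Chat)
    [IsAdicComplete ((ae k A a).map φ) Chat]
    (hφ : ∀ n : ℕ, Function.Bijective
      (Ideal.quotientMap (((ae k A a).map φ) ^ n) φ
        (Ideal.map_le_iff_le_comap.mp (le_of_eq (Ideal.map_pow φ (ae k A a) n)))))
    -- the induced `Chat`-module structures on `A` and `M`:
    (ψ : Chat →+* A) (hψ : ψ.comp φ = mulMap k A) :
    letI : Module Chat A := Module.compHom A ψ
    letI : Module Chat M := Module.compHom M ψ
    ∀ n : ℕ, Nonempty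
      ((((Ext (A ⊗[k] A) (ModuleCat (A ⊗[k] A)) n).obj
            (Opposite.op (ModuleCat.of (A ⊗[k] A) A))).obj
          (ModuleCat.of (A ⊗[k] A) M))
        ≃+
        (((Ext Chat (ModuleCat Chat) n).obj
            (Opposite.op (ModuleCat.of Chat A))).obj
          (ModuleCat.of Chat M))) := by
  intro n
  letI iA : Module Chat A := Module.compHom A ψ
  letI iM : Module Chat M := Module.compHom M ψ
  have hl : (ψ.comp φ).comp (Algebra.TensorProduct.includeLeftRingHom (R := k)) = RingHom.id A := by
    rw [hψ]
    ext x
    simp [mulMap]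
  have hr : (ψ.comp φ).comp (Algebra.TensorProduct.includeRight (R := k) (A := A)).toRingHom
      = RingHom.id A := by
    rw [hψ]
    ext x
    simp [mulMap]
  have hs : ∀ c, ψ (φ c) = mulMap k A c := fun c => by rw [← hψ]; rfl
  have D1 : ∀ n (x : Chat), ∃ c : A ⊗[k] A, x - φ c ∈ ((ae k A a).map φ) ^ n := by
    intro n x
    obtain ⟨q, hq⟩ := (hφ n).2 (Ideal.Quotient.mk _ x)
    obtain ⟨c, rfl⟩ := Ideal.Quotient.mk_surjective q
    refine ⟨c, ?_⟩
    rw [Ideal.quotientMap_mk] at hq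
    exact Ideal.Quotient.eq.1 hq.symm
  have D2 : ∀ n (c : A ⊗[k] A), φ c ∈ ((ae k A a).map φ) ^ n → c ∈ (ae k A a) ^ n := by
    intro n c h
    have h0 : Ideal.Quotient.mk ((ae k A a) ^ n) c = 0 := by
      apply (hφ n).1
      rw [Ideal.quotientMap_mk, map_zero]
      exact Ideal.Quotient.eq_zero_iff_mem.2 h
    exact Ideal.Quotient.eq_zero_iff_mem.1 h0
  refine HCC.main_compare (HCC.tp_left k A) (HCC.tp_right k A) a M φ
    ‹IsAdicComplete ((ae k A a).map φ) Chat› D1 D2 ψ hl hr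
    (ModuleCat.of Chat A) (ModuleCat.of (A ⊗[k] A) A) (ModuleCat.of (A ⊗[k] A) M) ?_ ?_ n
  · exact HCC.isoOf φ ψ (mulMap k A) hs A
  · exact HCC.isoOf φ ψ (mulMap k A) hs M
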